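/- arXiv:1912.08538 — 8 statements merged into one kernel-verified Lean document; each statement's English description precedes it below -/
import Mathlib

section
/- Let E_R ⊆ E(S) be a set of effects satisfying the consistency conditions (E1) and (E2). Then the set of meters M_{E_R} is simulation closed if and only if E_R is a convex subset of the real vector space of affine maps S → ℝ. -/
open scoped BigOperators

section GPT

variable {V : Type*} [NormedAddCommGroup V] [NormedSpace ℝ V]

/-- A function on a subset `S` is affine if it preserves convex combinations. -/
def IsAffineOn (S : Set V) (f : S → ℝ) : Prop :=
  ∀ (x y : V) (hx : x ∈ S) (hy : y ∈ S) (a b : ℝ), 0 ≤ a → 0 ≤ b → a + b = 1 →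
    ∀ (h : a • x + b • y ∈ S), f ⟨a • x + b • y, h⟩ = a * f ⟨x, hx⟩ + b * f ⟨y, hy⟩

/-- The set of effects on `S`: affine maps `S → ℝ` with values in `[0,1]`. -/
def Effects (S : Set V) : Set (S → ℝ) :=
  {f | IsAffineOn S f ∧ (∀ s, 0 ≤ f s) ∧ (∀ s, f s ≤ 1)}

/-- The unit effect `u`. -/
def unitEff (S : Set V) : S → ℝ := fun _ => 1

/-- A meter: a finite family of effects summing to the unit effect. -/
structure Meter (S : Set V) where
  n : ℕ
  eff : Fin n → S → ℝ
  mem_effects : ∀ x, eff x ∈ Effects S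
  sum_eq : ∑ x, eff x = unitEff S

/-- The range of a meter: all sums of effects over subsets of the outcome set. -/
def Meter.ran {S : Set V} (A : Meter S) : Set (S → ℝ) :=
  {f | ∃ Ω : Finset (Fin A.n), f = ∑ y ∈ Ω, A.eff y}

/-- A post-processing: a row-stochastic matrix. -/
def IsPostProcess {m k : ℕ} (ν : Fin m → Fin k → ℝ) : Prop :=
  (∀ x y, 0 ≤ ν x y) ∧ ∀ x, ∑ y, ν x y = 1

/-- The simulation closure of a set of meters: mixtures of post-processings. -/
def Sim {S : Set V} (ℬ : Set (Meter S)) : Set (Meter S) :=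
  {A | ∃ (m : ℕ) (B : Fin m → Meter S) (p : Fin m → ℝ)
      (ν : (i : Fin m) → Fin (B i).n → Fin A.n → ℝ),
      (∀ i, B i ∈ ℬ) ∧ (∀ i, 0 ≤ p i) ∧ (∑ i, p i = 1) ∧
      (∀ i, IsPostProcess (ν i)) ∧
      (∀ y, A.eff y = ∑ i, p i • ∑ x, ν i x y • (B i).eff x)}

/-- A set of meters is simulation closed if it equals its simulation closure. -/
def SimClosed {S : Set V} (M' : Set (Meter S)) : Prop := Sim M' = M'

/-- The meters whose range is contained in a given set of effects. -/
def MetersOf {S : Set V} (R : Set (S → ℝ)) : Set (Meter S) :=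
  {A | A.ran ⊆ R}

/-- The effects arising in the range of some meter in a given set of meters. -/
def EffectsOf {S : Set V} (M' : Set (Meter S)) : Set (S → ℝ) :=
  {e | e ∈ Effects S ∧ ∃ A ∈ M', e ∈ A.ran}

/-- Consistency condition (E1): the unit effect is available. -/
def CondE1 (S : Set V) (R : Set (S → ℝ)) : Prop := unitEff S ∈ R

/-- Consistency condition (E2): every available effect occurs in some available meter. -/
def CondE2 (S : Set V) (R : Set (S → ℝ)) : Prop :=
  ∀ e ∈ R, ∃ A ∈ MetersOf R, e ∈ A.ran

/-- The largest value of an effect on the state space. -/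
noncomputable def lmax {S : Set V} (f : S → ℝ) : ℝ := ⨆ s, f s

/-- The smallest value of an effect on the state space. -/
noncomputable def lmin {S : Set V} (f : S → ℝ) : ℝ := ⨅ s, f s

/-- Effectively `n`-tomic meters: the simulation closure of meters with at most
`n` outcomes. -/
def MEff (S : Set V) (n : ℕ) : Set (Meter S) := Sim {A : Meter S | A.n ≤ n}

/-- A convex subalgebra of the set of effects. -/
def IsConvexSubalgebra (S : Set V) (R : Set (S → ℝ)) : Prop :=
  R ⊆ Effects S ∧ unitEff S ∈ R ∧
  (∀ e ∈ R, unitEff S - e ∈ R) ∧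
  (∀ e ∈ R, ∀ f ∈ R, e + f ∈ Effects S → e + f ∈ R) ∧
  (∀ a : ℝ, a ∈ Set.Icc (0:ℝ) 1 → ∀ e ∈ R, a • e ∈ R)

/-- Two meters are compatible if both can be simulated from a single meter. -/
def Compatible {S : Set V} (A B : Meter S) : Prop :=
  ∃ C : Meter S, A ∈ Sim {C} ∧ B ∈ Sim {C}

/-- The set of meters compatible with a given meter. -/
def CompatSet {S : Set V} (A : Meter S) : Set (Meter S) :=
  {B | Compatible A B}

/-- The noise content of a meter with respect to trivial meters. -/
noncomputable def noiseContent {S : Set V} (B : Meter S) : ℝ :=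
  sSup {l : ℝ | l ∈ Set.Icc (0:ℝ) 1 ∧
    ∃ (p : Fin B.n → ℝ) (Ceff : Fin B.n → S → ℝ),
      (∀ x, 0 ≤ p x) ∧ (∑ x, p x = 1) ∧
      (∀ x, Ceff x ∈ Effects S) ∧ (∑ x, Ceff x = unitEff S) ∧
      ∀ x, B.eff x = l • (p x • unitEff S) + (1 - l) • Ceff x}

/-- The set `R_t` of meters that are `t`-noisy versions of some meter with the
same outcome set. -/
def Rt (S : Set V) (t : ℝ) : Set (Meter S) :=
  {A | ∃ (Beff : Fin A.n → S → ℝ) (p : Fin A.n → ℝ),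
      (∀ x, Beff x ∈ Effects S) ∧ (∑ x, Beff x = unitEff S) ∧
      (∀ x, 0 ≤ p x) ∧ (∑ x, p x = 1) ∧
      ∀ x, A.eff x = t • Beff x + ((1 - t) * p x) • unitEff S}

end GPT

/-- A convex set containing every finite sum of the family `b` contains the sums with weights in
`[0, 1]` on `T` and weight `1` on a disjoint `Ω`. -/
theorem Convex.sum_smul_add_sum_mem {E ι : Type*} [AddCommGroup E] [Module ℝ E]
    {R : Set E} (hR : Convex ℝ R) (b : ι → E) (hb : ∀ Ω : Finset ι, ∑ x ∈ Ω, b x ∈ R)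
    (w : ι → ℝ) (hw0 : ∀ x, 0 ≤ w x) (hw1 : ∀ x, w x ≤ 1) (T Ω : Finset ι)
    (hd : Disjoint T Ω) :
    ∑ x ∈ T, w x • b x + ∑ x ∈ Ω, b x ∈ R := by
  classical
  induction T using Finset.induction_on generalizing Ω with
  | empty => simpa using hb Ω
  | insert a T ha ih =>
    rw [Finset.disjoint_insert_left] at hd
    have hin := ih (insert a Ω) (Finset.disjoint_insert_right.2 ⟨ha, hd.2⟩)
    have hout := ih Ω hd.2
    have h := hR hin hout (hw0 a) (sub_nonneg.2 (hw1 a)) (by ring)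
    rw [Finset.sum_insert hd.1] at h
    rw [Finset.sum_insert ha]
    convert h using 1
    module

/-- A convex set containing all subset sums of a finite family contains its sums with weights in
`[0, 1]`. -/
theorem Convex.sum_smul_mem_of_subset_sums {E ι : Type*} [AddCommGroup E] [Module ℝ E]
    [Fintype ι] {R : Set E} (hR : Convex ℝ R) (b : ι → E)
    (hb : ∀ Ω : Finset ι, ∑ x ∈ Ω, b x ∈ R)
    (w : ι → ℝ) (hw0 : ∀ x, 0 ≤ w x) (hw1 : ∀ x, w x ≤ 1) :
    ∑ x, w x • b x ∈ R := by
  simpa using hR.sum_smul_add_sum_mem b hb w hw0 hw1 Finset.univ ∅ (Finset.disjoint_empty_right _)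

section GPT

variable {V : Type*} [NormedAddCommGroup V] [NormedSpace ℝ V] {S : Set V}

theorem subset_sim (ℬ : Set (Meter S)) : ℬ ⊆ Sim ℬ := by
  classical
  intro A hA
  refine ⟨1, fun _ => A, fun _ => 1, fun _ x y => if x = y then 1 else 0, fun _ => hA,
    fun _ => zero_le_one, by simp, fun _ => ⟨fun x y => ?_, fun x => by simp⟩, fun y => by simp⟩
  dsimp only
  split_ifs <;> norm_num

theorem sim_metersOf_subset {R : Set (S → ℝ)} (hR : Convex ℝ R) :
    Sim (MetersOf R) ⊆ MetersOf R := by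
  rintro A ⟨m, B, p, ν, hB, hp, hp1, hν, hA⟩ _ ⟨Ω, rfl⟩
  have hsum : ∑ y ∈ Ω, A.eff y =
      ∑ i, p i • ∑ x, (∑ y ∈ Ω, ν i x y) • (B i).eff x := by
    simp_rw [hA, Finset.sum_smul]
    rw [Finset.sum_comm]
    refine Finset.sum_congr rfl fun i _ => ?_
    rw [← Finset.smul_sum, Finset.sum_comm]
  rw [hsum]
  refine hR.sum_mem (fun i _ => hp i) hp1 fun i _ => ?_
  refine hR.sum_smul_mem_of_subset_sums _ (fun Ω' => hB i ⟨Ω', rfl⟩) _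
    (fun x => Finset.sum_nonneg fun y _ => (hν i).1 x y) fun x => ?_
  rw [← (hν i).2 x]
  exact Finset.sum_le_sum_of_subset_of_nonneg (Finset.subset_univ Ω)
    fun y _ _ => (hν i).1 x y

theorem convex_effects : Convex ℝ (Effects S) := by
  rintro e ⟨he, he0, he1⟩ f ⟨hf, hf0, hf1⟩ a b ha hb hab
  refine ⟨fun x y hx hy c d hc hd hcd h => ?_, fun s => ?_, fun s => ?_⟩
  · simp only [Pi.add_apply, Pi.smul_apply, smul_eq_mul, he x y hx hy c d hc hd hcd h,
      hf x y hx hy c d hc hd hcd h]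
    ring
  · exact add_nonneg (mul_nonneg ha (he0 s)) (mul_nonneg hb (hf0 s))
  · simp only [Pi.add_apply, Pi.smul_apply, smul_eq_mul]
    nlinarith [mul_le_mul_of_nonneg_left (he1 s) ha, mul_le_mul_of_nonneg_left (hf1 s) hb]

theorem unitEff_sub_mem_effects {e : S → ℝ} (he : e ∈ Effects S) :
    unitEff S - e ∈ Effects S := by
  refine ⟨fun x y hx hy a b ha hb hab h => ?_, fun s => sub_nonneg.2 (he.2.2 s),
    fun s => sub_le_self _ (he.2.1 s)⟩
  simp only [Pi.sub_apply, unitEff, he.1 x y hx hy a b ha hb hab h]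
  linear_combination -hab

/-- The two-outcome meter of an effect and its complement. -/
def binaryMeter (e : S → ℝ) (he : e ∈ Effects S) : Meter S where
  n := 2
  eff := ![e, unitEff S - e]
  mem_effects := Fin.forall_fin_two.2 ⟨he, unitEff_sub_mem_effects he⟩
  sum_eq := by simp

/-- Mixing the coarse-grainings of meters `A i` to subsets `Ω i` of outcomes yields the binary
meter of the mixed effect. -/
theorem binaryMeter_mem_sim {ℬ : Set (Meter S)} {m : ℕ} (A : Fin m → Meter S)
    (hA : ∀ i, A i ∈ ℬ) (Ω : ∀ i, Finset (Fin (A i).n)) (p : Fin m → ℝ) (hp : ∀ i, 0 ≤ p i)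
    (hp1 : ∑ i, p i = 1) (e : S → ℝ) (he : e ∈ Effects S)
    (heq : e = ∑ i, p i • ∑ x ∈ Ω i, (A i).eff x) :
    binaryMeter e he ∈ Sim ℬ := by
  classical
  have h0 : e = ∑ i, p i • ∑ x, (if x ∈ Ω i then (1 : ℝ) else 0) • (A i).eff x := by
    simpa [ite_smul, Finset.sum_ite_mem] using heq
  have h1 : unitEff S - e =
      ∑ i, p i • ∑ x, (1 - if x ∈ Ω i then (1 : ℝ) else 0) • (A i).eff x := by
    simp_rw [sub_smul, one_smul, Finset.sum_sub_distrib, smul_sub, Finset.sum_sub_distrib,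
      ← h0, (A _).sum_eq, ← Finset.sum_smul, hp1, one_smul]
  refine ⟨m, A, p, fun i x => ![if x ∈ Ω i then (1 : ℝ) else 0,
    1 - if x ∈ Ω i then (1 : ℝ) else 0], hA, hp, hp1, fun i => ⟨fun x => ?_, fun x => ?_⟩,
    Fin.forall_fin_two.2 ⟨h0, h1⟩⟩
  · refine Fin.forall_fin_two.2 ⟨?_, ?_⟩ <;> by_cases hx : x ∈ Ω i <;> simp [hx]
  · exact (Fin.sum_univ_two _).trans (add_sub_cancel _ _)

end GPT

/-- For `E_R` satisfying (E1) and (E2), the induced set of meters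
`M_{E_R}` is simulation closed iff `E_R` is convex. -/
theorem metersOf_simClosed_iff_convex
    {V : Type*} [NormedAddCommGroup V] [NormedSpace ℝ V] [FiniteDimensional ℝ V]
    {S : Set V} (hne : S.Nonempty) (hcomp : IsCompact S) (hconv : Convex ℝ S)
    (R : Set (S → ℝ)) (hR : R ⊆ Effects S)
    (h1 : CondE1 S R) (h2 : CondE2 S R) :
    SimClosed (MetersOf R) ↔ Convex ℝ R := by
  refine ⟨fun hclosed e he f hf a b ha hb hab => ?_, fun hconvR =>
    (sim_metersOf_subset hconvR).antisymm (subset_sim _)⟩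
  have hE : ∀ i, ![e, f] i ∈ R := Fin.forall_fin_two.2 ⟨he, hf⟩
  choose A hA Ω hΩ using fun i => h2 _ (hE i)
  have hg := convex_effects (hR he) (hR hf) ha hb hab
  have hmem := binaryMeter_mem_sim A hA Ω ![a, b] (Fin.forall_fin_two.2 ⟨ha, hb⟩)
    (by simpa using hab) _ hg (by simp [← hΩ])
  rw [show Sim (MetersOf R) = MetersOf R from hclosed] at hmem
  exact hmem ⟨{(0 : Fin 2)}, (Finset.sum_singleton _ _).symm⟩
end

section
/- Let V be a finite-dimensional real vector space, C ⊂ V a proper cone, u ∈ C nonzero, and suppose the linear effect algebra [0,u]_C generates V. A subset R ⊆ [0,u]_C is a convex subalgebra if and only if u ∈ R and there exist finitely many elements e_1, …, e_n ∈ [0,u]_C such that R = span_ℝ{e_1, …, e_n} ∩ [0,u]_C, i.e., R = { e ∈ [0,u]_C : e = Σ_i r_i e_i for some r_i ∈ ℝ }. -/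
open scoped BigOperators

section ConvexSubalgebra

variable {V : Type*} [AddCommGroup V] [Module ℝ V] {C R : Set V} {u : V}

theorem smul_mem_of_le_unit
    (hCadd : ∀ x ∈ C, ∀ y ∈ C, x + y ∈ C)
    (hCsmul : ∀ a : ℝ, 0 ≤ a → ∀ x ∈ C, a • x ∈ C)
    (hRC : R ⊆ C)
    (hadd : ∀ e ∈ R, ∀ f ∈ R, u - (e + f) ∈ C → e + f ∈ R)
    (hsmul : ∀ a : ℝ, a ∈ Set.Icc (0 : ℝ) 1 → ∀ e ∈ R, a • e ∈ R)
    {t : ℝ} (ht : 0 ≤ t) {p : V} (hp : p ∈ R) (htp : u - t • p ∈ C) : t • p ∈ R := by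
  obtain ⟨n, hn⟩ := exists_nat_gt t
  have hn0 : (0 : ℝ) < n := ht.trans_lt hn
  set a := t / n with ha
  have ha0 : 0 ≤ a := by positivity
  have hna : (n : ℝ) * a = t := by rw [ha]; field_simp
  have hap : a • p ∈ R := hsmul a ⟨ha0, (div_le_one hn0).2 hn.le⟩ p hp
  have key : ∀ k : ℕ, k ≤ n → ((k : ℝ) * a) • p ∈ R := by
    intro k
    induction k with
    | zero => intro _; simpa using hsmul 0 ⟨le_rfl, zero_le_one⟩ p hp
    | succ k ih =>
      intro hk
      have hk' : ((k + 1 : ℕ) : ℝ) ≤ n := by exact_mod_cast hk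
      have hsum : (((k + 1 : ℕ) : ℝ) * a) • p = ((k : ℝ) * a) • p + a • p := by
        push_cast; module
      rw [hsum]
      refine hadd _ (ih (by omega)) _ hap ?_
      have hle : 0 ≤ t - ((k + 1 : ℕ) : ℝ) * a := by
        rw [← hna, ← sub_mul]
        exact mul_nonneg (sub_nonneg.2 hk') ha0
      have := hCadd _ htp _ (hCsmul _ hle p (hRC hp))
      rw [← hsum]
      convert this using 1
      module
  simpa only [hna] using key n le_rfl

theorem convexCombo_mem
    (hCadd : ∀ x ∈ C, ∀ y ∈ C, x + y ∈ C)
    (hCsmul : ∀ a : ℝ, 0 ≤ a → ∀ x ∈ C, a • x ∈ C)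
    (hR : R ⊆ {e | e ∈ C ∧ u - e ∈ C})
    (hadd : ∀ e ∈ R, ∀ f ∈ R, u - (e + f) ∈ C → e + f ∈ R)
    (hsmul : ∀ a : ℝ, a ∈ Set.Icc (0 : ℝ) 1 → ∀ e ∈ R, a • e ∈ R)
    {a b : ℝ} (ha : 0 ≤ a) (hb : 0 ≤ b) (hab : a + b = 1) {p q : V} (hp : p ∈ R) (hq : q ∈ R) :
    a • p + b • q ∈ R := by
  refine hadd _ (hsmul a ⟨ha, by linarith⟩ p hp) _ (hsmul b ⟨hb, by linarith⟩ q hq) ?_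
  have := hCadd _ (hCsmul a ha _ (hR hp).2) _ (hCsmul b hb _ (hR hq).2)
  obtain rfl : b = 1 - a := by linarith
  convert this using 1
  module

theorem exists_smul_sub_of_mem_span
    (hCadd : ∀ x ∈ C, ∀ y ∈ C, x + y ∈ C)
    (hCsmul : ∀ a : ℝ, 0 ≤ a → ∀ x ∈ C, a • x ∈ C)
    (hR : R ⊆ {e | e ∈ C ∧ u - e ∈ C}) (hRne : R.Nonempty)
    (hadd : ∀ e ∈ R, ∀ f ∈ R, u - (e + f) ∈ C → e + f ∈ R)
    (hsmul : ∀ a : ℝ, a ∈ Set.Icc (0 : ℝ) 1 → ∀ e ∈ R, a • e ∈ R)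
    {x : V} (hx : x ∈ Submodule.span ℝ R) :
    ∃ t : ℝ, 0 ≤ t ∧ ∃ p ∈ R, ∃ q ∈ R, x = t • (p - q) := by
  obtain ⟨r, hr⟩ := hRne
  induction hx using Submodule.span_induction with
  | mem x hx =>
    exact ⟨1, zero_le_one, x, hx, (0 : ℝ) • r, hsmul 0 ⟨le_rfl, zero_le_one⟩ r hr, by simp⟩
  | zero => exact ⟨0, le_rfl, r, hr, r, hr, by simp⟩
  | add x y _ _ hx hy =>
    obtain ⟨t, ht, p, hp, q, hq, rfl⟩ := hx
    obtain ⟨s, hs, p', hp', q', hq', rfl⟩ := hy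
    rcases (add_nonneg ht hs).eq_or_lt with h0 | hpos
    · obtain rfl : t = 0 := by linarith
      obtain rfl : s = 0 := by linarith
      exact ⟨0, le_rfl, r, hr, r, hr, by simp⟩
    · have hab : t / (t + s) + s / (t + s) = 1 := by field_simp
      have ha : 0 ≤ t / (t + s) := by positivity
      have hb : 0 ≤ s / (t + s) := by positivity
      refine ⟨t + s, hpos.le, _, convexCombo_mem hCadd hCsmul hR hadd hsmul ha hb hab hp hp',
        _, convexCombo_mem hCadd hCsmul hR hadd hsmul ha hb hab hq hq', ?_⟩
      have h1 : (t + s) * (t / (t + s)) = t := by field_simp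
      have h2 : (t + s) * (s / (t + s)) = s := by field_simp
      simp only [smul_sub, smul_add, smul_smul, h1, h2]
      abel
  | smul a x _ hx =>
    obtain ⟨t, ht, p, hp, q, hq, rfl⟩ := hx
    rcases le_total 0 a with ha | ha
    · exact ⟨a * t, mul_nonneg ha ht, p, hp, q, hq, by module⟩
    · exact ⟨-a * t, mul_nonneg (neg_nonneg.2 ha) ht, q, hq, p, hp, by module⟩

theorem mem_of_mem_span
    (hCadd : ∀ x ∈ C, ∀ y ∈ C, x + y ∈ C)
    (hCsmul : ∀ a : ℝ, 0 ≤ a → ∀ x ∈ C, a • x ∈ C)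
    (hR : R ⊆ {e | e ∈ C ∧ u - e ∈ C}) (hRne : R.Nonempty)
    (hcompl : ∀ e ∈ R, u - e ∈ R)
    (hadd : ∀ e ∈ R, ∀ f ∈ R, u - (e + f) ∈ C → e + f ∈ R)
    (hsmul : ∀ a : ℝ, a ∈ Set.Icc (0 : ℝ) 1 → ∀ e ∈ R, a • e ∈ R)
    {e : V} (he : e ∈ C) (heu : u - e ∈ C) (hspan : e ∈ Submodule.span ℝ R) : e ∈ R := by
  have hRC : R ⊆ C := fun x hx => (hR hx).1
  obtain ⟨t, ht, p, hp, q, hq, hepq⟩ :=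
    exists_smul_sub_of_mem_span hCadd hCsmul hR hRne hadd hsmul hspan
  have hm := convexCombo_mem hCadd hCsmul hR hadd hsmul (a := 1 / 2) (b := 1 / 2)
    (by norm_num) (by norm_num) (by norm_num) hp (hcompl q hq)
  have hinv : (1 + t)⁻¹ * (1 + t) = 1 := inv_mul_cancel₀ (by positivity)
  -- The mixture `(e + t • u) / (1 + t)` is a multiple of the midpoint of `p` and `u - q`.
  have hmix : u - ((1 + t)⁻¹ * (2 * t)) • ((1 / 2 : ℝ) • p + (1 / 2 : ℝ) • (u - q)) =
      (1 + t)⁻¹ • (u - e) := by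
    rw [hepq]
    trans (1 - (1 + t)⁻¹ * (1 + t)) • u + (1 + t)⁻¹ • (u - t • (p - q))
    · module
    · rw [hinv, sub_self, zero_smul, zero_add]
  have hg := hcompl _ (smul_mem_of_le_unit hCadd hCsmul hRC hadd hsmul
    (by positivity : 0 ≤ (1 + t)⁻¹ * (2 * t)) hm
    (by rw [hmix]; exact hCsmul _ (by positivity) _ heu))
  rw [hmix] at hg
  have hscale : (1 + t) • (1 + t)⁻¹ • (u - e) = u - e := by
    rw [smul_smul, mul_comm, hinv, one_smul]
  have hue := smul_mem_of_le_unit hCadd hCsmul hRC hadd hsmul (by positivity : 0 ≤ 1 + t) hg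
    (by rw [hscale, sub_sub_cancel]; exact he)
  rw [hscale] at hue
  simpa using hcompl _ hue

end ConvexSubalgebra

/-- In a linear effect algebra `[0,u]_C` generating a
finite-dimensional space `V`, a subset `R ⊆ [0,u]_C` is a convex subalgebra iff
`u ∈ R` and `R` is the intersection of `[0,u]_C` with the real span of finitely
many elements `e_1, …, e_n ∈ [0,u]_C`. -/
theorem convexSubalgebra_iff_span_inter
    {V : Type*} [AddCommGroup V] [Module ℝ V] [FiniteDimensional ℝ V]
    (C : Set V)
    (hCadd : ∀ x ∈ C, ∀ y ∈ C, x + y ∈ C)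
    (hCsmul : ∀ a : ℝ, 0 ≤ a → ∀ x ∈ C, a • x ∈ C)
    (hCproper : ∀ x ∈ C, -x ∈ C → x = 0)
    (u : V) (hu : u ∈ C) (hu0 : u ≠ 0)
    (hgen : Submodule.span ℝ {e | e ∈ C ∧ u - e ∈ C} = (⊤ : Submodule ℝ V))
    (R : Set V) (hR : R ⊆ {e | e ∈ C ∧ u - e ∈ C}) :
    (u ∈ R ∧
     (∀ e ∈ R, u - e ∈ R) ∧
     (∀ e ∈ R, ∀ f ∈ R, u - (e + f) ∈ C → e + f ∈ R) ∧
     (∀ a : ℝ, a ∈ Set.Icc (0:ℝ) 1 → ∀ e ∈ R, a • e ∈ R))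
    ↔
    (u ∈ R ∧ ∃ (n : ℕ) (ev : Fin n → V),
      (∀ i, ev i ∈ {e | e ∈ C ∧ u - e ∈ C}) ∧
      R = {f | f ∈ {e | e ∈ C ∧ u - e ∈ C} ∧ ∃ r : Fin n → ℝ, f = ∑ i, r i • ev i}) := by
  have hsum : ∀ (n : ℕ) (ev : Fin n → V) (f : V),
      (∃ r : Fin n → ℝ, f = ∑ i, r i • ev i) ↔ f ∈ Submodule.span ℝ (Set.range ev) := by
    intro n ev f
    simp only [Submodule.mem_span_range_iff_exists_fun, eq_comm]
  simp only [hsum]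
  constructor
  · rintro ⟨huR, hcompl, hadd, hsmul⟩
    obtain ⟨ev, hev, hspan, -⟩ := Submodule.exists_fun_fin_finrank_span_eq ℝ R
    refine ⟨huR, _, ev, fun i => hR (hev i), ?_⟩
    rw [hspan]
    ext f
    exact ⟨fun hf => ⟨hR hf, Submodule.subset_span hf⟩, fun ⟨⟨hf, hfu⟩, hfs⟩ =>
      mem_of_mem_span hCadd hCsmul hR ⟨u, huR⟩ hcompl hadd hsmul hf hfu hfs⟩
  · rintro ⟨huR, n, ev, -, rfl⟩
    refine ⟨huR, ?_, ?_, ?_⟩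
    · rintro e ⟨⟨he, heu⟩, hes⟩
      exact ⟨⟨heu, by rwa [sub_sub_cancel]⟩, Submodule.sub_mem _ huR.2 hes⟩
    · rintro e ⟨⟨he, -⟩, hes⟩ f ⟨⟨hf, -⟩, hfs⟩ hef
      exact ⟨⟨hCadd _ he _ hf, hef⟩, Submodule.add_mem _ hes hfs⟩
    · rintro a ⟨ha0, ha1⟩ e ⟨⟨he, heu⟩, hes⟩
      refine ⟨⟨hCsmul a ha0 e he, ?_⟩, Submodule.smul_mem _ a hes⟩
      have := hCadd _ heu _ (hCsmul (1 - a) (sub_nonneg.2 ha1) e he)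
      convert this using 1
      module
end

section
/- Let A be a meter with n outcomes whose effects A_1, …, A_n are linearly independent in the vector space of affine maps S → ℝ, and let E' = { e ∈ E(S) : e = Σ_{x=1}^n r_x A_x for some r_1, …, r_n ∈ [0,1] }. Then sim({A}) = M_{E'}; in particular, the restriction sim({A}) is induced by a restriction on effects. -/
open scoped BigOperators

/-- Every element of the range of a meter is an effect. -/
theorem Meter.ran_subset_effects {V : Type*} [NormedAddCommGroup V] [NormedSpace ℝ V]
    {S : Set V} (C : Meter S) : C.ran ⊆ Effects S := by
  rintro _ ⟨Ω, rfl⟩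
  refine ⟨?_, fun s => ?_, fun s => ?_⟩
  · intro x y hx hy a b ha hb hab h
    simp only [Finset.sum_apply, Finset.mul_sum, ← Finset.sum_add_distrib]
    exact Finset.sum_congr rfl fun i _ => (C.mem_effects i).1 x y hx hy a b ha hb hab h
  · rw [Finset.sum_apply]
    exact Finset.sum_nonneg fun i _ => (C.mem_effects i).2.1 s
  · have hs : ∑ i, C.eff i s = 1 := by
      rw [← Finset.sum_apply, C.sum_eq, unitEff]
    rw [Finset.sum_apply, ← hs]
    exact Finset.sum_le_sum_of_subset_of_nonneg (Finset.subset_univ Ω)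
      fun i _ _ => (C.mem_effects i).2.1 s

/-- Simulating from a single meter amounts to post-processing it once. -/
theorem mem_sim_singleton_iff {V : Type*} [NormedAddCommGroup V] [NormedSpace ℝ V]
    {S : Set V} {A C : Meter S} :
    C ∈ Sim {A} ↔ ∃ ν : Fin A.n → Fin C.n → ℝ, IsPostProcess ν ∧
      ∀ y, C.eff y = ∑ x, ν x y • A.eff x := by
  constructor
  · rintro ⟨m, B, p, ν, hB, hp, hp1, hν, hC⟩
    obtain rfl : B = fun _ => A := funext hB
    refine ⟨fun x y => ∑ i, p i * ν i x y, ⟨fun x y => ?_, fun x => ?_⟩, fun y => ?_⟩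
    · exact Finset.sum_nonneg fun i _ => mul_nonneg (hp i) ((hν i).1 x y)
    · rw [Finset.sum_comm]
      simp only [← Finset.mul_sum, (hν _).2 x, mul_one, hp1]
    · simp only [hC y, Finset.smul_sum, Finset.sum_smul, mul_smul]
      exact Finset.sum_comm
  · rintro ⟨ν, hν, hC⟩
    exact ⟨1, fun _ => A, fun _ => 1, fun _ => ν, fun _ => rfl, fun _ => zero_le_one, by simp,
      fun _ => hν, fun y => by simpa using hC y⟩

/-- For a meter `A` with linearly independent effects,
`sim({A}) = M_{E'}` where `E'` is the set of effects of the form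
`∑ r_x A_x` with coefficients in `[0,1]`. -/
theorem sim_singleton_eq_metersOf
    {V : Type*} [NormedAddCommGroup V] [NormedSpace ℝ V] [FiniteDimensional ℝ V]
    {S : Set V} (hne : S.Nonempty) (hcomp : IsCompact S) (hconv : Convex ℝ S)
    (A : Meter S) (hli : LinearIndependent ℝ A.eff) :
    Sim {A} = MetersOf {e | e ∈ Effects S ∧
      ∃ r : Fin A.n → ℝ, (∀ x, r x ∈ Set.Icc (0:ℝ) 1) ∧ e = ∑ x, r x • A.eff x} := by
  ext C
  rw [mem_sim_singleton_iff]
  constructor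
  · rintro ⟨ν, ⟨hν0, hν1⟩, hC⟩ e he
    refine ⟨C.ran_subset_effects he, ?_⟩
    obtain ⟨Ω, rfl⟩ := he
    refine ⟨fun x => ∑ y ∈ Ω, ν x y, fun x => ⟨Finset.sum_nonneg fun y _ => hν0 x y, ?_⟩, ?_⟩
    · rw [← hν1 x]
      exact Finset.sum_le_sum_of_subset_of_nonneg (Finset.subset_univ Ω) fun y _ _ => hν0 x y
    · simp only [hC, Finset.sum_smul]
      exact Finset.sum_comm
  · intro hC
    have hr (y : Fin C.n) : ∃ r : Fin A.n → ℝ,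
        (∀ x, r x ∈ Set.Icc (0 : ℝ) 1) ∧ C.eff y = ∑ x, r x • A.eff x :=
      (hC ⟨{y}, (Finset.sum_singleton _ _).symm⟩).2
    choose r hr01 hr using hr
    refine ⟨fun x y => r y x, ⟨fun x y => (hr01 y x).1, fun x => ?_⟩, hr⟩
    have hsum : ∑ x, (∑ y, r y x) • A.eff x = ∑ x, (1 : ℝ) • A.eff x := by
      simp only [one_smul, A.sum_eq, ← C.sum_eq, hr, Finset.sum_smul]
      exact Finset.sum_comm
    exact congrFun (hli.fintypeLinearCombination_injective hsum) x
end

section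
/- Let M' ⊆ M(S) be a simulation closed set of meters such that every effect belongs to the range of some meter in M' (i.e., E_{M'} = E(S)). Then every effectively dichotomic meter belongs to M', i.e., M_{2-eff} ⊆ M'. -/
open scoped BigOperators

/-- A simulation may use a larger set of meters. -/
theorem Sim.mono {V : Type*} {S : Set V} [NormedAddCommGroup V] [NormedSpace ℝ V]
    {ℬ 𝒞 : Set (Meter S)} (h : ℬ ⊆ 𝒞) : Sim ℬ ⊆ Sim 𝒞 := by
  rintro A ⟨m, B, p, ν, hB, hrest⟩
  exact ⟨m, B, p, ν, fun i => h (hB i), hrest⟩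

/-- Merging outcomes of a meter along a map of outcome sets is a simulation. -/
theorem mem_Sim_of_relabel {V : Type*} {S : Set V} [NormedAddCommGroup V] [NormedSpace ℝ V]
    {ℬ : Set (Meter S)} {A B : Meter S} (hA : A ∈ ℬ) (f : Fin A.n → Fin B.n)
    (hf : ∀ y, B.eff y = ∑ x with f x = y, A.eff x) : B ∈ Sim ℬ := by
  refine ⟨1, fun _ => A, fun _ => 1, fun _ x y => if f x = y then 1 else 0,
    fun _ => hA, fun _ => zero_le_one, by simp, fun _ => ⟨fun x y => ?_, fun x => by simp⟩,
    fun y => ?_⟩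
  · dsimp only
    split_ifs <;> norm_num
  · simp [hf y, Finset.sum_filter]

/-- A meter with at most two outcomes is simulated by any set of meters having all effects in
its ranges. -/
theorem mem_Sim_of_n_le_two {V : Type*} {S : Set V} [NormedAddCommGroup V] [NormedSpace ℝ V]
    (hne : S.Nonempty) {ℬ : Set (Meter S)} (hfull : EffectsOf ℬ = Effects S)
    {B : Meter S} (hB : B.n ≤ 2) : B ∈ Sim ℬ := by
  obtain ⟨n, eff, hmem, hsum⟩ := B
  dsimp only at hB
  interval_cases n
  · obtain ⟨s, hs⟩ := hne
    have := congrFun hsum ⟨s, hs⟩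
    simp [unitEff] at this
  · obtain ⟨-, A, hA, -⟩ : eff 0 ∈ EffectsOf ℬ := hfull ▸ hmem 0
    refine mem_Sim_of_relabel hA (fun _ => (0 : Fin 1)) fun y => ?_
    obtain rfl : y = (0 : Fin 1) := Subsingleton.elim _ _
    simpa [A.sum_eq] using hsum
  · obtain ⟨-, A, hA, Ω, hΩ⟩ : eff 0 ∈ EffectsOf ℬ := hfull ▸ hmem 0
    have hcompl : eff 1 = ∑ x ∈ Ωᶜ, A.eff x := by
      have h := (Finset.sum_add_sum_compl Ω A.eff).trans A.sum_eq
      rw [← hsum, Fin.sum_univ_two, hΩ] at h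
      exact (add_left_cancel h).symm
    refine mem_Sim_of_relabel hA (fun x => if x ∈ Ω then (0 : Fin 2) else 1) fun y => ?_
    change Fin 2 at y
    fin_cases y
    · refine hΩ.trans (Finset.sum_congr ?_ fun _ _ => rfl)
      ext x
      by_cases hx : x ∈ Ω <;> simp [hx]
    · refine hcompl.trans (Finset.sum_congr ?_ fun _ _ => rfl)
      ext x
      by_cases hx : x ∈ Ω <;> simp [hx]

/-- Every simulation closed restriction whose induced effects are
all effects contains all effectively dichotomic meters. -/
theorem mEff_two_subset_of_full_effects
    {V : Type*} [NormedAddCommGroup V] [NormedSpace ℝ V] [FiniteDimensional ℝ V]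
    {S : Set V} (hne : S.Nonempty) (hcomp : IsCompact S) (hconv : Convex ℝ S)
    (M' : Set (Meter S)) (hsc : SimClosed M') (hfull : EffectsOf M' = Effects S) :
    MEff S 2 ⊆ M' := by
  exact (Sim.mono fun B hB => hsc ▸ mem_Sim_of_n_le_two hne hfull hB).trans hsc.subset
end

section
/- Let A be a meter. If there exists an outcome y ∈ Ω_A such that Σ_{x ≠ y} λ_max(A_x) ≤ 1, then A is effectively dichotomic, i.e., A ∈ M_{2-eff}. -/
open scoped BigOperators

section Dichotomic

variable {V : Type*} [NormedAddCommGroup V] [NormedSpace ℝ V] {S : Set V}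

/-- The two-outcome meter `(e, u - e)` of an effect `e`. -/
def dichotomicMeter {e : S → ℝ} (he : e ∈ Effects S) : Meter S where
  n := 2
  eff := ![e, unitEff S - e]
  mem_effects := Fin.forall_fin_two.2 ⟨he, unitEff_sub_mem_effects he⟩
  sum_eq := by simp

theorem le_lmax {e : S → ℝ} (he : e ∈ Effects S) (s : S) : e s ≤ lmax e :=
  le_ciSup (f := e) ⟨1, by rintro _ ⟨t, rfl⟩; exact he.2.2 t⟩ s

theorem lmax_nonneg {e : S → ℝ} (he : e ∈ Effects S) : 0 ≤ lmax e :=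
  Real.iSup_nonneg he.2.1

theorem inv_lmax_smul_mem_effects {e : S → ℝ} (he : e ∈ Effects S) :
    (lmax e)⁻¹ • e ∈ Effects S := by
  have hinv : 0 ≤ (lmax e)⁻¹ := inv_nonneg.2 (lmax_nonneg he)
  refine ⟨?_, fun s => mul_nonneg hinv (he.2.1 s), fun s => ?_⟩
  · intro x y hx hy a b ha hb hab hS
    simp only [Pi.smul_apply, smul_eq_mul, he.1 x y hx hy a b ha hb hab hS]
    ring
  · exact (mul_le_mul_of_nonneg_left (le_lmax he s) hinv).trans inv_mul_le_one

theorem lmax_mul_inv_lmax_mul {e : S → ℝ} (he : e ∈ Effects S) (s : S) :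
    lmax e * ((lmax e)⁻¹ * e s) = e s := by
  rcases eq_or_ne (lmax e) 0 with h0 | h0
  · have : e s = 0 := le_antisymm (h0 ▸ le_lmax he s) (he.2.1 s)
    simp [this]
  · exact mul_inv_cancel_left₀ h0 _

end Dichotomic

/-- If for some outcome `y` of a meter `A` the sum of `λ_max` of
the remaining effects is at most `1`, then `A` is effectively dichotomic. -/
theorem effectively_dichotomic_of_lmax_sum_le_one
    {V : Type*} [NormedAddCommGroup V] [NormedSpace ℝ V] [FiniteDimensional ℝ V]
    {S : Set V} (hne : S.Nonempty) (hcomp : IsCompact S) (hconv : Convex ℝ S)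
    (A : Meter S) (y : Fin A.n)
    (h : ∑ x ∈ Finset.univ.erase y, lmax (A.eff x) ≤ 1) :
    A ∈ MEff S 2 := by
  set q : ℝ := 1 - ∑ x ∈ Finset.univ.erase y, lmax (A.eff x) with hq
  let p : Fin A.n → ℝ := fun i => if i = y then q else lmax (A.eff i)
  have hp : ∀ i ∈ Finset.univ.erase y, p i = lmax (A.eff i) := fun i hi =>
    if_neg (Finset.ne_of_mem_erase hi)
  have hpy : p y = q := if_pos rfl
  refine ⟨A.n, fun i => dichotomicMeter (inv_lmax_smul_mem_effects (A.mem_effects i)), p,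
    fun i (j : Fin 2) k => if k = ![i, y] j then 1 else 0,
    fun i => le_refl 2, fun i => ?_, ?_, fun i => ⟨fun j k => ?_, fun j => ?_⟩, fun k => ?_⟩
  · by_cases hi : i = y
    · subst hi
      rw [hpy]
      linarith
    · rw [hp i (by simp [hi])]
      exact lmax_nonneg (A.mem_effects i)
  · rw [← Finset.add_sum_erase _ _ (Finset.mem_univ y), Finset.sum_congr rfl hp, hpy, hq]
    ring
  · positivity
  · simp
  · ext s
    suffices A.eff k s = ∑ i, p i * ((if k = i then 1 else 0) * ((lmax (A.eff i))⁻¹ * A.eff i s) +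
        (if k = y then 1 else 0) * (1 - (lmax (A.eff i))⁻¹ * A.eff i s)) by
      rw [this, Finset.sum_apply]
      refine Finset.sum_congr rfl fun i _ => ?_
      change _ = p i * (∑ j : Fin 2, (if k = ![i, y] j then (1 : ℝ) else 0) •
        (![(lmax (A.eff i))⁻¹ • A.eff i, unitEff S - (lmax (A.eff i))⁻¹ • A.eff i] :
          Fin 2 → S → ℝ) j) s
      rw [Fin.sum_univ_two]
      rfl
    by_cases hk : k = y
    · subst hk
      have hsum : A.eff k s + ∑ x ∈ Finset.univ.erase k, A.eff x s = 1 := by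
        rw [Finset.add_sum_erase _ (fun x => A.eff x s) (Finset.mem_univ k),
          ← Finset.sum_apply, A.sum_eq]
        rfl
      have hterm : ∀ i ∈ Finset.univ.erase k,
          p i * ((if k = i then 1 else 0) * ((lmax (A.eff i))⁻¹ * A.eff i s) +
            (if k = k then 1 else 0) * (1 - (lmax (A.eff i))⁻¹ * A.eff i s)) =
          lmax (A.eff i) - A.eff i s := fun i hi => by
        rw [hp i hi, if_neg (Finset.ne_of_mem_erase hi).symm, if_pos rfl]
        linear_combination -lmax_mul_inv_lmax_mul (A.mem_effects i) s
      rw [← Finset.add_sum_erase _ _ (Finset.mem_univ k), Finset.sum_congr rfl hterm,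
        Finset.sum_sub_distrib, hpy, if_pos rfl]
      linear_combination hsum - hq
    · simp only [if_neg hk, zero_mul, add_zero, ite_mul, one_mul, mul_ite, mul_zero,
        Finset.sum_ite_eq, Finset.mem_univ, if_true]
      rw [hp k (by simp [hk]), lmax_mul_inv_lmax_mul (A.mem_effects k) s]
end

section
/- Let A be a meter and n ≥ 2 an integer. If Σ_{x ∈ Ω_A} λ_max(A_x) > n, then A is not effectively n-tomic, i.e., A ∉ M_{n-eff}. -/
open scoped BigOperators

/-- The maximum of an effect in a mixture of post-processings is at most the mixed column
sum of the post-processing matrices. -/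
theorem lmax_mixture_le {V : Type*} [NormedAddCommGroup V] [NormedSpace ℝ V] {S : Set V}
    (hne : S.Nonempty) {m : ℕ} (B : Fin m → Meter S) {p : Fin m → ℝ} (hp : ∀ i, 0 ≤ p i)
    {w : (i : Fin m) → Fin (B i).n → ℝ} (hw : ∀ i x, 0 ≤ w i x) :
    lmax (∑ i, p i • ∑ x, w i x • (B i).eff x) ≤ ∑ i, p i * ∑ x, w i x := by
  have : Nonempty S := hne.to_subtype
  refine ciSup_le fun s => ?_
  simp only [Finset.sum_apply, Pi.smul_apply, smul_eq_mul]
  exact Finset.sum_le_sum fun i _ => mul_le_mul_of_nonneg_left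
    (Finset.sum_le_sum fun x _ => mul_le_of_le_one_right (hw i x)
      (((B i).mem_effects x).2.2 s)) (hp i)

/-- The entries of a row-stochastic matrix sum to the number of rows. -/
theorem IsPostProcess.sum_sum {m k : ℕ} {ν : Fin m → Fin k → ℝ} (hν : IsPostProcess ν) :
    ∑ y, ∑ x, ν x y = m := by
  rw [Finset.sum_comm]
  simp [hν.2]

/-- If the sum of the maximal values of the effects of a meter
`A` exceeds `n`, then `A` is not effectively `n`-tomic. -/
theorem not_effectively_n_tomic_of_lmax_sum_gt
    {V : Type*} [NormedAddCommGroup V] [NormedSpace ℝ V] [FiniteDimensional ℝ V]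
    {S : Set V} (hne : S.Nonempty) (hcomp : IsCompact S) (hconv : Convex ℝ S)
    (A : Meter S) (n : ℕ) (hn : 2 ≤ n)
    (h : (n : ℝ) < ∑ x, lmax (A.eff x)) :
    A ∉ MEff S n := by
  rintro ⟨m, B, p, ν, hB, hp, hp1, hν, hA⟩
  refine h.not_ge ?_
  calc ∑ y, lmax (A.eff y)
      ≤ ∑ y, ∑ i, p i * ∑ x, ν i x y := Finset.sum_le_sum fun y _ => by
        rw [hA y]
        exact lmax_mixture_le hne B hp fun i x => (hν i).1 x y
    _ = ∑ i, p i * ((B i).n : ℝ) := by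
        rw [Finset.sum_comm]
        simp_rw [← Finset.mul_sum, (hν _).sum_sum]
    _ ≤ ∑ i, p i * (n : ℝ) := Finset.sum_le_sum fun i _ =>
        mul_le_mul_of_nonneg_left (Nat.cast_le.2 (hB i)) (hp i)
    _ = n := by rw [← Finset.sum_mul, hp1, one_mul]
end

section
/- Suppose a meter A perfectly discriminates m states, i.e., there exist states s_1, …, s_m ∈ S and outcomes x_1, …, x_m ∈ Ω_A such that A_{x_i}(s_j) = 1 if i = j and A_{x_i}(s_j) = 0 if i ≠ j. If A is effectively n-tomic (A ∈ M_{n-eff}), then m ≤ n. -/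
open scoped BigOperators

/-- An effectively `n`-tomic meter can perfectly discriminate at
most `n` states. -/
theorem perfect_discrimination_le_of_mEff
    {V : Type*} [NormedAddCommGroup V] [NormedSpace ℝ V] [FiniteDimensional ℝ V]
    {S : Set V} (hne : S.Nonempty) (hcomp : IsCompact S) (hconv : Convex ℝ S)
    (A : Meter S) (n m : ℕ) (s : Fin m → S) (x : Fin m → Fin A.n)
    (hdisc : ∀ i j, A.eff (x i) (s j) = if i = j then 1 else 0)
    (hA : A ∈ MEff S n) :
    m ≤ n := by
  have hinj : Function.Injective x := by
    intro i j hij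
    by_contra hne'
    have h1 := hdisc i j
    have h2 := hdisc j j
    rw [hij] at h1
    simp [hne'] at h1 h2
    linarith
  obtain ⟨k, B, p, ν, hB, hp, hp1, hν, hAeff⟩ := hA
  have hrow : ∀ i b, ∑ j, ν i b (x j) ≤ 1 := by
    intro i b
    rw [← (hν i).2 b, ← Finset.sum_image (g := x) (f := ν i b) hinj.injOn]
    exact Finset.sum_le_sum_of_subset_of_nonneg (Finset.subset_univ _)
      fun y _ _ => (hν i).1 b y
  have hsim : ∀ i, ∑ j, ∑ b, ν i b (x j) * (B i).eff b (s j) ≤ n := by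
    intro i
    calc ∑ j, ∑ b, ν i b (x j) * (B i).eff b (s j)
        ≤ ∑ j, ∑ b, ν i b (x j) := by
          gcongr with j _ b _
          exact mul_le_of_le_one_right ((hν i).1 _ _) (((B i).mem_effects b).2.2 _)
      _ = ∑ b, ∑ j, ν i b (x j) := Finset.sum_comm
      _ ≤ ∑ _b : Fin (B i).n, (1 : ℝ) := Finset.sum_le_sum fun b _ => hrow i b
      _ = ((B i).n : ℝ) := by simp
      _ ≤ n := by exact_mod_cast hB i
  have hm : (m : ℝ) ≤ n := by
    calc (m : ℝ) = ∑ j, A.eff (x j) (s j) := by simp [hdisc]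
      _ = ∑ j, ∑ i, p i * ∑ b, ν i b (x j) * (B i).eff b (s j) := by
          simp [hAeff, Finset.sum_apply]
      _ = ∑ i, p i * ∑ j, ∑ b, ν i b (x j) * (B i).eff b (s j) := by
          rw [Finset.sum_comm]
          simp only [Finset.mul_sum]
      _ ≤ ∑ i, p i * n := by
          gcongr with i _
          · exact hp i
          · exact hsim i
      _ = n := by rw [← Finset.sum_mul, hp1, one_mul]
  exact_mod_cast hm
end

section
/- Let A be a meter with n outcomes such that A_1, …, A_m are indecomposable effects for some m ≤ n, and assume that for all i, j ∈ {1, …, m} with i ≠ j: (i) A_j ≠ t A_i for all t > 0, and (ii) t_i A_i + t_j A_j ≠ u for all t_i, t_j > 0. If Σ_{k=1}^m λ_max(A_k) > 1, then A is not effectively dichotomic, i.e., A ∉ M_{2-eff}. -/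
open scoped BigOperators

/-- An effect is indecomposable if any decomposition into a sum of two nonzero
effects consists of positive multiples of itself. -/
def Indecomposable {V : Type*} [NormedAddCommGroup V] [NormedSpace ℝ V]
    (S : Set V) (f : S → ℝ) : Prop :=
  f ∈ Effects S ∧ f ≠ 0 ∧
  ∀ f₁ f₂ : S → ℝ, f₁ ∈ Effects S → f₂ ∈ Effects S → f₁ ≠ 0 → f₂ ≠ 0 →
    f = f₁ + f₂ →
    ∃ a₁ a₂ : ℝ, 0 < a₁ ∧ 0 < a₂ ∧ f = a₁ • f₁ ∧ f = a₂ • f₂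

section GPT

variable {V : Type*} [NormedAddCommGroup V] [NormedSpace ℝ V] {S : Set V}

/-- A nonzero nonnegative affine function below an indecomposable effect is a positive multiple
of it. -/
theorem Indecomposable.exists_pos_smul {f g : S → ℝ} (hf : Indecomposable S f)
    (hg : IsAffineOn S g) (hg0 : ∀ s, 0 ≤ g s) (hgf : ∀ s, g s ≤ f s) (hne : g ≠ 0) :
    ∃ t : ℝ, 0 < t ∧ g = t • f := by
  obtain ⟨⟨hfa, hf0, hf1⟩, -, hdec⟩ := hf
  by_cases h : f - g = 0
  · exact ⟨1, one_pos, by rw [one_smul, ← sub_eq_zero.mp h]⟩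
  · have hg' : g ∈ Effects S := ⟨hg, hg0, fun s => (hgf s).trans (hf1 s)⟩
    have hsub : f - g ∈ Effects S := by
      refine ⟨fun x y hx hy a b ha hb hab hmem => ?_, fun s => sub_nonneg.mpr (hgf s),
        fun s => ?_⟩
      · simp only [Pi.sub_apply]
        rw [hfa x y hx hy a b ha hb hab hmem, hg x y hx hy a b ha hb hab hmem]
        ring
      · simp only [Pi.sub_apply]
        linarith [hf1 s, hg0 s]
    obtain ⟨a, -, ha, -, hfa', -⟩ := hdec g (f - g) hg' hsub hne h (by simp)
    refine ⟨a⁻¹, inv_pos.mpr ha, ?_⟩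
    rw [hfa', smul_smul, inv_mul_cancel₀ ha.ne', one_smul]

theorem IsAffineOn.smul {f : S → ℝ} (hf : IsAffineOn S f) (c : ℝ) : IsAffineOn S (c • f) := by
  intro x y hx hy a b ha hb hab hmem
  simp only [Pi.smul_apply, smul_eq_mul]
  rw [hf x y hx hy a b ha hb hab hmem]
  ring

theorem IsPostProcess.le_one {m k : ℕ} {ν : Fin m → Fin k → ℝ} (hν : IsPostProcess ν)
    (x : Fin m) (y : Fin k) : ν x y ≤ 1 :=
  hν.2 x ▸ Finset.single_le_sum (fun z _ => hν.1 x z) (Finset.mem_univ y)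

theorem Meter.sum_eff_apply (B : Meter S) (s : S) : ∑ x, B.eff x s = 1 := by
  simpa [unitEff] using congrFun B.sum_eq s

theorem Meter.postProcess_nonneg (B : Meter S) {k : ℕ} {ν : Fin B.n → Fin k → ℝ}
    (hν : IsPostProcess ν) (y : Fin k) (s : S) : 0 ≤ (∑ x, ν x y • B.eff x) s := by
  simp only [Finset.sum_apply, Pi.smul_apply, smul_eq_mul]
  exact Finset.sum_nonneg fun x _ => mul_nonneg (hν.1 x y) ((B.mem_effects x).2.1 s)

theorem Meter.postProcess_le_one (B : Meter S) {k : ℕ} {ν : Fin B.n → Fin k → ℝ}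
    (hν : IsPostProcess ν) (y : Fin k) (s : S) : (∑ x, ν x y • B.eff x) s ≤ 1 := by
  simp only [Finset.sum_apply, Pi.smul_apply, smul_eq_mul]
  rw [← B.sum_eff_apply s]
  exact Finset.sum_le_sum fun x _ =>
    mul_le_of_le_one_left ((B.mem_effects x).2.1 s) (hν.le_one x y)

/-- If an indecomposable effect dominates a positive multiple of a nonzero post-processed effect
of `B`, then some effect of `B` is a positive multiple of it. -/
theorem Indecomposable.exists_eff_eq_smul {f : S → ℝ} (hf : Indecomposable S f) (B : Meter S)
    {k : ℕ} {ν : Fin B.n → Fin k → ℝ} (hν : IsPostProcess ν) (y : Fin k) {p : ℝ} (hp : 0 < p)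
    (hle : ∀ s, p * (∑ x, ν x y • B.eff x) s ≤ f s) (hne : ∑ x, ν x y • B.eff x ≠ 0) :
    ∃ x, ∃ t : ℝ, 0 < t ∧ B.eff x = t • f := by
  obtain ⟨x, -, hx⟩ := Finset.exists_ne_zero_of_sum_ne_zero hne
  have hνx : 0 < ν x y :=
    lt_of_le_of_ne (hν.1 x y) fun h => hx (by rw [← h, zero_smul])
  have hc : 0 < p * ν x y := mul_pos hp hνx
  have hB0 := fun x => (B.mem_effects x).2.1
  obtain ⟨t, ht, hteq⟩ := hf.exists_pos_smul ((B.mem_effects x).1.smul (p * ν x y))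
    (fun s => mul_nonneg hc.le (hB0 x s))
    (fun s => by
      refine le_trans ?_ (hle s)
      simp only [Pi.smul_apply, smul_eq_mul, Finset.sum_apply, mul_assoc]
      exact mul_le_mul_of_nonneg_left
        (Finset.single_le_sum (f := fun x => ν x y * B.eff x s)
          (fun z _ => mul_nonneg (hν.1 z y) (hB0 z s)) (Finset.mem_univ x)) hp.le)
    (by
      rw [mul_smul]
      exact smul_ne_zero hp.ne' hx)
  refine ⟨x, (p * ν x y)⁻¹ * t, mul_pos (inv_pos.mpr hc) ht, ?_⟩
  rw [mul_smul, ← hteq, smul_smul, inv_mul_cancel₀ hc.ne', one_smul]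

/-- Two distinct outcomes of a meter with at most two outcomes carry effects summing to `u`. -/
theorem Meter.eff_add_eff_eq_unitEff (B : Meter S) (hB : B.n ≤ 2) {x x' : Fin B.n}
    (hx : x ≠ x') : B.eff x + B.eff x' = unitEff S := by
  rw [← B.sum_eq, ← Finset.sum_pair hx]
  refine Finset.sum_subset (Finset.subset_univ _) fun z _ hz => absurd ?_ hz
  simp only [Finset.mem_insert, Finset.mem_singleton]
  omega

end GPT

/-- A meter whose first `m` effects are indecomposable, pairwise
non-proportional, no two of which can be scaled to sum to the unit, and whose
maximal values sum to more than `1`, is not effectively dichotomic. -/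
theorem not_effectively_dichotomic_of_indecomposable
    {V : Type*} [NormedAddCommGroup V] [NormedSpace ℝ V] [FiniteDimensional ℝ V]
    {S : Set V} (hne : S.Nonempty) (hcomp : IsCompact S) (hconv : Convex ℝ S)
    (A : Meter S) (m : ℕ) (hm : m ≤ A.n)
    (hind : ∀ i : Fin m, Indecomposable S (A.eff (Fin.castLE hm i)))
    (hprop : ∀ i j : Fin m, i ≠ j → ∀ t : ℝ, 0 < t →
      A.eff (Fin.castLE hm j) ≠ t • A.eff (Fin.castLE hm i))
    (hsum : ∀ i j : Fin m, i ≠ j → ∀ ti tj : ℝ, 0 < ti → 0 < tj →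
      ti • A.eff (Fin.castLE hm i) + tj • A.eff (Fin.castLE hm j) ≠ unitEff S)
    (hlmax : 1 < ∑ k : Fin m, lmax (A.eff (Fin.castLE hm k))) :
    A ∉ MEff S 2 := by
  classical
  rintro ⟨M, B, p, ν, hB, hp0, hp1, hν, hA⟩
  have : Nonempty S := hne.to_subtype
  let G : Fin M → Fin m → S → ℝ := fun i k => ∑ x, ν i x (Fin.castLE hm k) • (B i).eff x
  have hG0 : ∀ i k s, 0 ≤ G i k s := fun i k s => (B i).postProcess_nonneg (hν i) _ s
  have hAG : ∀ k s, A.eff (Fin.castLE hm k) s = ∑ i, p i * G i k s := by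
    intro k s
    rw [hA]
    simp [G, Finset.sum_apply]
  have hGle : ∀ i k s, p i * G i k s ≤ A.eff (Fin.castLE hm k) s := fun i k s => by
    rw [hAG]
    exact Finset.single_le_sum (f := fun i => p i * G i k s)
      (fun j _ => mul_nonneg (hp0 j) (hG0 j k s)) (Finset.mem_univ i)
  have huniq : ∀ i, 0 < p i → ∀ k k', G i k ≠ 0 → G i k' ≠ 0 → k = k' := by
    intro i hpi k k' hk hk'
    by_contra hkk
    obtain ⟨x, t, ht, hx⟩ :=
      (hind k).exists_eff_eq_smul (B i) (hν i) _ hpi (hGle i k) hk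
    obtain ⟨x', t', ht', hx'⟩ :=
      (hind k').exists_eff_eq_smul (B i) (hν i) _ hpi (hGle i k') hk'
    by_cases hxx : x = x'
    · subst hxx
      refine hprop k k' hkk (t'⁻¹ * t) (mul_pos (inv_pos.mpr ht') ht) ?_
      rw [mul_smul, ← hx, hx', smul_smul, inv_mul_cancel₀ ht'.ne', one_smul]
    · refine hsum k k' hkk t t' ht ht' ?_
      rw [← hx, ← hx']
      exact (B i).eff_add_eff_eq_unitEff (hB i) hxx
  let c : Fin M → Fin m → ℝ := fun i k => if G i k ≠ 0 then 1 else 0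
  have hlc : ∀ k, lmax (A.eff (Fin.castLE hm k)) ≤ ∑ i, p i * c i k := fun k =>
    ciSup_le fun s => by
      rw [hAG]
      refine Finset.sum_le_sum fun i _ => mul_le_mul_of_nonneg_left ?_ (hp0 i)
      by_cases h : G i k = 0
      · simp [c, h]
      · simp only [c, if_pos h]
        exact (B i).postProcess_le_one (hν i) (Fin.castLE hm k) s
  have hcsum : ∀ i, 0 < p i → ∑ k, c i k ≤ 1 := by
    intro i hpi
    simp only [c, Finset.sum_boole]
    exact_mod_cast Finset.card_le_one.mpr fun k hk k' hk' =>
      huniq i hpi k k' (Finset.mem_filter.mp hk).2 (Finset.mem_filter.mp hk').2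
  refine hlmax.not_ge ?_
  calc ∑ k, lmax (A.eff (Fin.castLE hm k)) ≤ ∑ k, ∑ i, p i * c i k :=
        Finset.sum_le_sum fun k _ => hlc k
    _ = ∑ i, p i * ∑ k, c i k := by
        rw [Finset.sum_comm]
        simp only [Finset.mul_sum]
    _ ≤ ∑ i, p i := Finset.sum_le_sum fun i _ => by
        rcases (hp0 i).eq_or_lt with h | h
        · simp [← h]
        · exact mul_le_of_le_one_right h.le (hcsum i h)
    _ = 1 := hp1
end
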